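/- Let g : (ℕ → Bool) → ℝ be g(u) = ∑'_{n} (if u(n) then 2 else 0) · (1/3)^{n+1}, and let μ = Measure.map g β be the pushforward of the fair-coin measure (the Cantor distribution). Then μ is a probability measure that has no atoms and is mutually singular with respect to Lebesgue measure on ℝ. -/

import Mathlib

open MeasureTheory

/-- `β` is the fair-coin measure on bit-streams: the countable product of copies of the
probability measure on `Bool` giving mass `1/2` to `true` and `1/2` to `false`.
Since the infinite product of probability measures is uniquely determined by its values
on cylinder sets, we characterize `β` by: every cylinder fixing the coordinates in a
finite set `s` has measure `(1/2) ^ s.card`. -/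
def IsFairCoinMeasure (β : Measure (ℕ → Bool)) : Prop :=
  ∀ (s : Finset ℕ) (f : ℕ → Bool),
    β {u : ℕ → Bool | ∀ i ∈ s, u i = f i} = (1 / 2 : ENNReal) ^ s.card

/-- The ternary Cantor set is Lebesgue-null. -/
theorem volume_cantorSet_eq_zero : volume cantorSet = 0 := by
  have hfin : volume cantorSet ≠ ⊤ := isCompact_cantorSet.measure_lt_top.ne
  have h1 : volume ((· / 3) '' cantorSet) = ENNReal.ofReal 3⁻¹ * volume cantorSet := by
    have h : ((· / 3) '' cantorSet : Set ℝ) = AffineMap.homothety (0 : ℝ) (3⁻¹ : ℝ) '' cantorSet := by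
      congr 1
      ext x
      simp [AffineMap.homothety_apply, div_eq_inv_mul]
    rw [h, Measure.addHaar_image_homothety]
    simp
  have h2 : volume ((fun x : ℝ ↦ (2 + x) / 3) '' cantorSet)
      = ENNReal.ofReal 3⁻¹ * volume cantorSet := by
    have h : ((fun x : ℝ ↦ (2 + x) / 3) '' cantorSet : Set ℝ)
        = AffineMap.homothety (1 : ℝ) (3⁻¹ : ℝ) '' cantorSet := by
      congr 1
      ext x
      simp [AffineMap.homothety_apply]
      ring
    rw [h, Measure.addHaar_image_homothety]
    simp
  have h3 : volume cantorSet ≤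
      ENNReal.ofReal 3⁻¹ * volume cantorSet + ENNReal.ofReal 3⁻¹ * volume cantorSet := by
    conv_lhs => rw [cantorSet_eq_union_halves]
    refine (measure_union_le _ _).trans ?_
    rw [h1, h2]
  lift volume cantorSet to NNReal using hfin with v hv
  have h4 : v ≤ Real.toNNReal 3⁻¹ * v + Real.toNNReal 3⁻¹ * v := by
    rw [ENNReal.ofReal] at h3
    exact_mod_cast h3
  have h5 : (v : ℝ) ≤ 3⁻¹ * v + 3⁻¹ * v := by
    have := NNReal.coe_le_coe.2 h4
    simpa [Real.coe_toNNReal] using this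
  have h6 : (0 : ℝ) ≤ v := v.2
  have h7 : (v : ℝ) = 0 := by linarith
  exact_mod_cast h7

/-- The Cantor distribution `μ`, the pushforward of the fair-coin measure `β` along
`g u = ∑' n, (if u n then 2 else 0) * (1/3)^(n+1)`, is a probability measure that has
no atoms (every singleton has measure zero) and is mutually singular with respect to
Lebesgue measure on `ℝ`. -/
theorem cantor_distribution_singular
    (β : Measure (ℕ → Bool)) (hβ : IsFairCoinMeasure β)
    (g : (ℕ → Bool) → ℝ)
    (hg : ∀ u : ℕ → Bool,
      g u = ∑' n : ℕ, (if u n then (2 : ℝ) else 0) * (1 / 3) ^ (n + 1))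
    (μ : Measure ℝ) (hμ : μ = Measure.map g β) :
    IsProbabilityMeasure μ ∧ (∀ x : ℝ, μ {x} = 0) ∧ μ ⟂ₘ volume := by
  have hg' : g = fun u ↦ ((cantorSetHomeomorphNatToBool.symm u : cantorSet) : ℝ) := by
    funext u
    change g u = Real.ofDigits (fun i ↦ cond (u i) (2 : Fin 3) 0)
    rw [hg, Real.ofDigits]
    refine tsum_congr fun n ↦ ?_
    cases h : u n <;> simp [Real.ofDigitsTerm, h]
  have hcont : Continuous g := by
    rw [hg']
    exact continuous_subtype_val.comp cantorSetHomeomorphNatToBool.symm.continuous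
  have hinj : Function.Injective g := by
    rw [hg']
    exact Subtype.val_injective.comp cantorSetHomeomorphNatToBool.symm.injective
  have hmem : ∀ u, g u ∈ cantorSet := by
    intro u
    rw [hg']
    exact Subtype.property _
  have hmeas : Measurable g := hcont.measurable
  have hprob : IsProbabilityMeasure β := ⟨by simpa using hβ ∅ (fun _ ↦ true)⟩
  have hsing : ∀ u, β {u} = 0 := by
    intro u
    have hle : ∀ n : ℕ, β {u} ≤ (1 / 2 : ENNReal) ^ n := by
      intro n
      have h := hβ (Finset.range n) u
      rw [Finset.card_range] at h
      rw [← h]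
      apply measure_mono
      rintro v rfl i _
      rfl
    have hlim : Filter.Tendsto (fun n : ℕ ↦ (1 / 2 : ENNReal) ^ n) Filter.atTop (nhds 0) :=
      ENNReal.tendsto_pow_atTop_nhds_zero_of_lt_one (by simp)
    exact le_antisymm (ge_of_tendsto' hlim hle) bot_le
  subst hμ
  refine ⟨Measure.isProbabilityMeasure_map hmeas.aemeasurable, ?_, ?_⟩
  · intro x
    rw [Measure.map_apply hmeas (measurableSet_singleton x)]
    have hsub : (g ⁻¹' {x}).Subsingleton := by
      intro a ha b hb
      exact hinj (ha.trans hb.symm)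
    rcases hsub.eq_empty_or_singleton with h | ⟨u, h⟩
    · rw [h, measure_empty]
    · rw [h, hsing]
  · refine ⟨cantorSetᶜ, isClosed_cantorSet.measurableSet.compl, ?_, ?_⟩
    · rw [Measure.map_apply hmeas isClosed_cantorSet.measurableSet.compl]
      have h : g ⁻¹' cantorSetᶜ = ∅ := by
        ext u
        simp [hmem u]
      rw [h, measure_empty]
    · rw [compl_compl, volume_cantorSet_eq_zero]
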